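/- arXiv:2509.01143 — 2 statements merged into one kernel-verified Lean document; each statement's English description precedes it below -/
import Mathlib

section
/- The n-th moment of the operator P = m_t + √λ(a_s† + a_s) + λ k_s in the vacuum state equals the weighted sum over non-crossing partitions: φ(P^n) = Σ_{π ∈ NC(n)} λ^{|π|} s^{td₁(π)} t^{td₂(π)}, where td₁(π) = Σ_{B ∈ π} dp(ℓ_B) and td₂(π) = Σ_{B ∈ π, |B| ≥ 3} (|B| − 2) dp(ℓ_B). -/
open scoped Classical

/-- `π` is a partition of `[n] = {1, …, n}`: nonempty pairwise disjoint blocks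
whose union is `{1, …, n}`. -/
def IsPartitionOf (n : ℕ) (π : Finset (Finset ℕ)) : Prop :=
  (∀ B ∈ π, B.Nonempty) ∧
  (∀ B ∈ π, ∀ C ∈ π, B ≠ C → Disjoint B C) ∧
  (∀ a : ℕ, a ∈ Finset.Icc 1 n ↔ ∃ B ∈ π, a ∈ B)

/-- `π` is non-crossing: there are no blocks `B ≠ C` and `b₁ < c₁ < b₂ < c₂`
with `b₁, b₂ ∈ B` and `c₁, c₂ ∈ C`. -/
def NonCrossing (π : Finset (Finset ℕ)) : Prop :=
  ¬ ∃ B ∈ π, ∃ C ∈ π, B ≠ C ∧ ∃ b₁ ∈ B, ∃ c₁ ∈ C, ∃ b₂ ∈ B, ∃ c₂ ∈ C,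
      b₁ < c₁ ∧ c₁ < b₂ ∧ b₂ < c₂

/-- `dp π a` is the number of blocks `C` of `π` that cover `a`, i.e. with
`a ∉ C` and `min C < a < max C`. -/
noncomputable def dp (π : Finset (Finset ℕ)) (a : ℕ) : ℕ :=
  (π.filter fun C => a ∉ C ∧ (∃ x ∈ C, x < a) ∧ (∃ y ∈ C, a < y)).card

/-- The set `NC(n)` of non-crossing partitions of `[n]`, as a `Finset`. -/
noncomputable def NCset (n : ℕ) : Finset (Finset (Finset ℕ)) :=
  ((Finset.Icc 1 n).powerset.powerset).filter fun π =>
    IsPartitionOf n π ∧ NonCrossing π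

/-- `td₁(π) = Σ_{B ∈ π} dp(ℓ_B)`, the total depth of the blocks by their
last (maximal) elements; for `B` nonempty, `B.sup id = max B`. -/
noncomputable def td1 (π : Finset (Finset ℕ)) : ℕ :=
  ∑ B ∈ π, dp π (B.sup id)

/-- `td₂(π) = Σ_{B ∈ π, |B| ≥ 3} (|B| − 2) dp(ℓ_B)` (for `|B| ≤ 2` the factor
`|B| − 2` vanishes in `ℕ`). -/
noncomputable def td2 (π : Finset (Finset ℕ)) : ℕ :=
  ∑ B ∈ π, (B.card - 2) * dp π (B.sup id)

/-- The basis vector `ξ^{⊗ m}` of the one-mode Fock space, modeled as `ℕ →₀ ℝ`. -/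
noncomputable def e (m : ℕ) : ℕ →₀ ℝ := Finsupp.single m 1

/-- The `s`-weighted inner product on the one-mode Fock space. -/
noncomputable def ip (s : ℝ) (v w : ℕ →₀ ℝ) : ℝ :=
  ∑ m ∈ v.support ∪ w.support, s ^ (m * (m - 1) / 2) * v m * w m

structure Val (n : ℕ) (stk : List (Finset ℕ)) (cl : Finset (Finset ℕ)) : Prop where
  ne1 : ∀ B ∈ stk, ∃ b, b ∈ B
  ne2 : ∀ B ∈ cl, ∃ b, b ∈ B
  pw : stk.Pairwise (fun B C => ∀ b ∈ B, ∀ c ∈ C, c < b)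
  dj : ∀ B ∈ cl, ∀ C ∈ cl, ∀ a, a ∈ B → a ∈ C → B = C
  nc : ∀ B ∈ cl, ∀ C ∈ cl, ∀ b₁ ∈ B, ∀ c₁ ∈ C, ∀ b₂ ∈ B, ∀ c₂ ∈ C,
    b₁ < c₁ → c₁ < b₂ → b₂ < c₂ → B = C
  dj2 : ∀ B ∈ stk, ∀ C ∈ cl, ∀ a, a ∈ B → a ∉ C
  nc2 : ∀ B ∈ stk, ∀ C ∈ cl, ∀ b ∈ B, ∀ x ∈ C, ∀ y ∈ C, x < b → b < y → False
  le1 : ∀ B ∈ stk, ∀ a ∈ B, 1 ≤ a ∧ a ≤ n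
  le2 : ∀ B ∈ cl, ∀ a ∈ B, 1 ≤ a ∧ a ≤ n
  cov : ∀ a, 1 ≤ a → a ≤ n → (∃ B ∈ stk, a ∈ B) ∨ ∃ B ∈ cl, a ∈ B

noncomputable def succs (n : ℕ) :
    List (Finset ℕ) × Finset (Finset ℕ) → Finset (List (Finset ℕ) × Finset (Finset ℕ))
  | ([], cl) => {([{n+1}], cl), ([], insert {n+1} cl)}
  | (T :: r, cl) => {({n+1} :: T :: r, cl), (T :: r, insert {n+1} cl),
      (insert (n+1) T :: r, cl), (r, insert (insert (n+1) T) cl)}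

theorem val_open {n stk cl} (h : Val n stk cl) : Val (n+1) ({n+1} :: stk) cl := by
  obtain ⟨h1, h2, h3, h4, h5, h6, h7, h8, h9, h10⟩ := h
  constructor
  · simpa using h1
  · exact h2
  · simp only [List.pairwise_cons]; clear h5 h7; grind
  · exact h4
  · exact h5
  · clear h5 h7; grind
  · intro B hB C hC
    rcases List.mem_cons.1 hB with rfl | hB
    · clear h5 h7; grind
    · exact h7 B hB C hC
  · clear h5 h7; grind
  · clear h5 h7; grind
  · intro a ha hb
    by_cases hh : a = n+1
    · left; exact ⟨{n+1}, by simp, by simp [hh]⟩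
    · clear h5 h7; grind

theorem val_single {n stk cl} (h : Val n stk cl) : Val (n+1) stk (insert {n+1} cl) := by
  obtain ⟨h1, h2, h3, h4, h5, h6, h7, h8, h9, h10⟩ := h
  constructor
  · exact h1
  · intro B hB; rcases Finset.mem_insert.1 hB with rfl | hB
    · simp
    · exact h2 B hB
  · exact h3
  · clear h5 h7; grind
  · intro B hB C hC
    rcases Finset.mem_insert.1 hB with rfl | hB <;> rcases Finset.mem_insert.1 hC with rfl | hC
    · simp
    · clear h5 h7; grind
    · clear h5 h7; grind
    · exact h5 B hB C hC
  · clear h5 h7; grind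
  · intro B hB C hC
    rcases Finset.mem_insert.1 hC with rfl | hC
    · clear h5 h7; grind
    · exact h7 B hB C hC
  · clear h5 h7; grind
  · clear h5 h7; grind
  · intro a ha hb
    by_cases hh : a = n+1
    · right; exact ⟨{n+1}, by simp, by simp [hh]⟩
    · clear h5 h7; grind

theorem val_mid {n T r cl} (h : Val n (T :: r) cl) : Val (n+1) (insert (n+1) T :: r) cl := by
  obtain ⟨h1, h2, h3, h4, h5, h6, h7, h8, h9, h10⟩ := h
  simp only [List.pairwise_cons] at h3
  constructor
  · clear h5 h7; grind
  · exact h2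
  · simp only [List.pairwise_cons]; clear h5 h7; grind
  · exact h4
  · exact h5
  · clear h5 h7; grind
  · intro B hB C hC
    rcases List.mem_cons.1 hB with rfl | hB
    · have := h7 T (by simp) C hC; clear h5 h7; grind
    · exact h7 B (by simp [hB]) C hC
  · clear h5 h7; grind
  · clear h5 h7; grind
  · intro a ha hb
    by_cases hh : a = n+1
    · left; exact ⟨insert (n+1) T, by simp, by simp [hh]⟩
    · rcases h10 a ha (by omega) with ⟨B, hB, hB2⟩ | hB
      · rcases List.mem_cons.1 hB with rfl | hB
        · left; exact ⟨insert (n+1) B, by simp, by simp [hB2]⟩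
        · left; exact ⟨B, by simp [hB], hB2⟩
      · right; exact hB

theorem val_close {n T r cl} (h : Val n (T :: r) cl) :
    Val (n+1) r (insert (insert (n+1) T) cl) := by
  obtain ⟨h1, h2, h3, h4, h5, h6, h7, h8, h9, h10⟩ := h
  simp only [List.pairwise_cons] at h3
  constructor
  · clear h5 h7; grind
  · clear h5 h7; grind
  · exact h3.2
  · clear h5 h7; grind
  · intro B hB C hC
    rcases Finset.mem_insert.1 hB with rfl | hB <;> rcases Finset.mem_insert.1 hC with rfl | hC
    · simp
    · have := h7 T (by simp) C hC; clear h5 h7; grind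
    · have := h7 T (by simp) B hB; clear h5 h7; grind
    · exact h5 B hB C hC
  · clear h5 h7; grind
  · intro B hB C hC
    rcases Finset.mem_insert.1 hC with rfl | hC
    · clear h5 h7; grind
    · exact h7 B (by simp [hB]) C hC
  · clear h5 h7; grind
  · clear h5 h7; grind
  · intro a ha hb
    by_cases hh : a = n+1
    · right; exact ⟨insert (n+1) T, by simp, by simp [hh]⟩
    · rcases h10 a ha (by omega) with ⟨B, hB, hB2⟩ | ⟨B, hB, hB2⟩
      · rcases List.mem_cons.1 hB with rfl | hB
        · right; exact ⟨insert (n+1) B, by simp, by simp [hB2]⟩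
        · left; exact ⟨B, hB, hB2⟩
      · right; exact ⟨B, by simp [hB], hB2⟩

theorem val_succs {n x y} (h : Val n x.1 x.2) (hy : y ∈ succs n x) : Val (n+1) y.1 y.2 := by
  obtain ⟨stk, cl⟩ := x
  cases stk with
  | nil =>
    simp only [succs, Finset.mem_insert, Finset.mem_singleton] at hy
    rcases hy with rfl | rfl
    · exact val_open h
    · exact val_single h
  | cons T r =>
    simp only [succs, Finset.mem_insert, Finset.mem_singleton] at hy
    rcases hy with rfl | rfl | rfl | rfl
    · exact val_open h
    · exact val_single h
    · exact val_mid h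
    · exact val_close h

theorem mem_succs {n stk cl y} : y ∈ succs n (stk, cl) ↔
    y = ({n+1} :: stk, cl) ∨ y = (stk, insert {n+1} cl) ∨
    ∃ T r, stk = T :: r ∧ (y = (insert (n+1) T :: r, cl) ∨ y = (r, insert (insert (n+1) T) cl)) := by
  cases stk <;> simp [succs]

theorem unique_pred {n x x' y} (h : Val n x.1 x.2) (h' : Val n x'.1 x'.2)
    (hy : y ∈ succs n x) (hy' : y ∈ succs n x') : x = x' := by
  obtain ⟨s1, c1⟩ := x
  obtain ⟨s2, c2⟩ := x'
  have a1 : ∀ B ∈ s1, n+1 ∉ B := fun B hB hh => by have := h.le1 B hB _ hh; omega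
  have a2 : ∀ B ∈ c1, n+1 ∉ B := fun B hB hh => by have := h.le2 B hB _ hh; omega
  have a3 : ∀ B ∈ s2, n+1 ∉ B := fun B hB hh => by have := h'.le1 B hB _ hh; omega
  have a4 : ∀ B ∈ c2, n+1 ∉ B := fun B hB hh => by have := h'.le2 B hB _ hh; omega
  have a5 := h.ne1
  have a6 := h'.ne1
  rw [mem_succs] at hy hy'
  have key : ∀ (A B : Finset ℕ) (c d : Finset (Finset ℕ)), n+1 ∈ A → n+1 ∈ B →
      (∀ B ∈ c, n+1 ∉ B) → (∀ B ∈ d, n+1 ∉ B) → insert A c = insert B d → A = B ∧ c = d := by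
    intro A B c d hA hB hc hd hh
    have e1 : A = B := by
      have : A ∈ insert B d := hh ▸ Finset.mem_insert_self A c
      grind
    subst e1
    refine ⟨rfl, ?_⟩
    rw [← Finset.erase_insert (a := A) (s := c) (by grind), hh, Finset.erase_insert (by grind)]
  have key2 : ∀ (A B : Finset ℕ), n+1 ∉ A → n+1 ∉ B → insert (n+1) A = insert (n+1) B → A = B := by
    intro A B hA hB hh
    rw [← Finset.erase_insert hA, hh, Finset.erase_insert hB]
  have key3 : ∀ A : Finset ℕ, n+1 ∉ A → (∃ b, b ∈ A) → {n+1} ≠ insert (n+1) A := by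
    intro A hA ⟨b, hb⟩ hh
    have : b ∈ ({n+1} : Finset ℕ) := by rw [hh]; simp [hb]
    grind
  have key4 : ∀ (A : Finset ℕ) (c d : Finset (Finset ℕ)), n+1 ∈ A → (∀ B ∈ d, n+1 ∉ B) → insert A c ≠ d := by
    intro A c d hA hd hh
    exact hd A (hh ▸ Finset.mem_insert_self A c) hA
  have sg : n+1 ∈ ({n+1} : Finset ℕ) := by simp
  rcases hy with rfl | rfl | ⟨T, r, rfl, rfl | rfl⟩ <;>
  rcases hy' with hh | hh | ⟨T', r', rfl, hh | hh⟩ <;>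
    simp only [Prod.mk.injEq, List.cons.injEq] at hh ⊢
  · exact ⟨hh.1.2, hh.2⟩
  · exact absurd hh.2.symm (key4 _ _ _ sg a2)
  · exact absurd hh.1.1 (key3 _ (a3 _ (by simp)) (a6 _ (by simp)))
  · exact absurd hh.2.symm (key4 _ _ _ (by simp) a2)
  · exact absurd hh.2 (key4 _ _ _ sg a4)
  · exact ⟨hh.1, (key _ _ _ _ sg sg a2 a4 hh.2).2⟩
  · exact absurd hh.2 (key4 _ _ _ sg a4)
  · exact absurd (key _ _ _ _ sg (by simp) a2 a4 hh.2).1 (key3 _ (a3 _ (by simp)) (a6 _ (by simp)))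
  · exact absurd hh.1.1.symm (key3 _ (a1 _ (by simp)) (a5 _ (by simp)))
  · exact absurd hh.2.symm (key4 _ _ _ sg a2)
  · exact ⟨⟨key2 _ _ (a1 _ (by simp)) (a3 _ (by simp)) hh.1.1, hh.1.2⟩, hh.2⟩
  · exact absurd hh.2.symm (key4 _ _ _ (by simp) a2)
  · exact absurd hh.2 (key4 _ _ _ (by simp) a4)
  · exact absurd (key _ _ _ _ (by simp) sg a2 a4 hh.2).1.symm
      (key3 _ (a1 _ (by simp)) (a5 _ (by simp)))
  · exact absurd hh.2 (key4 _ _ _ (by simp) a4)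
  · obtain ⟨e1, e2⟩ := key _ _ _ _ (by simp) (by simp) a2 a4 hh.2
    exact ⟨⟨key2 _ _ (a1 _ (by simp)) (a3 _ (by simp)) e1, hh.1⟩, e2⟩

set_option maxHeartbeats 1000000 in
theorem exists_pred {n y} (h : Val (n+1) y.1 y.2) : ∃ x, Val n x.1 x.2 ∧ y ∈ succs n x := by
  obtain ⟨stk, cl⟩ := y
  obtain ⟨h1, h2, h3, h4, h5, h6, h7, h8, h9, h10⟩ := h
  dsimp only at *
  rcases h10 (n+1) (by omega) le_rfl with ⟨T, hT, hn⟩ | ⟨T, hT, hn⟩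
  · cases stk with
    | nil => simp at hT
    | cons A r =>
      simp only [List.pairwise_cons] at h3
      have hTA : T = A := by
        rcases List.mem_cons.1 hT with h | h
        · exact h
        · obtain ⟨b, hb⟩ := h1 A (by simp)
          have := h3.1 T h b hb _ hn
          have := h8 A (by simp) b hb
          omega
      subst hTA
      have hr : ∀ B ∈ r, n+1 ∉ B := fun B hB hh => by
        have := h3.1 B hB _ hn _ hh; omega
      have hc : ∀ B ∈ cl, n+1 ∉ B := fun B hB hh => h6 T (by simp) B hB _ hn hh
      by_cases hs : T = {n+1}
      · subst hs
        refine ⟨(r, cl), ?_, by rw [mem_succs]; simp⟩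
        constructor <;> dsimp only
        · clear h5 h7; grind
        · exact h2
        · exact h3.2
        · exact h4
        · exact h5
        · clear h5 h7; grind
        · intro B hB; exact h7 B (by simp [hB])
        · clear h5 h7; grind
        · clear h5 h7; grind
        · intro a ha hb
          rcases h10 a ha (by omega) with ⟨B, hB, hB2⟩ | hB
          · rcases List.mem_cons.1 hB with rfl | hB
            · simp only [Finset.mem_singleton] at hB2; omega
            · left; exact ⟨B, hB, hB2⟩
          · right; exact hB
      · refine ⟨(T.erase (n+1) :: r, cl), ?_, ?_⟩
        · constructor <;> dsimp only
          · intro B hB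
            rcases List.mem_cons.1 hB with rfl | hB
            · by_contra hcon
              push Not at hcon
              apply hs
              ext b
              have := hcon b
              clear h5 h7 h4 h6 h10
              grind
            · exact h1 B (by simp [hB])
          · exact h2
          · simp only [List.pairwise_cons]; clear h5 h7; grind
          · exact h4
          · exact h5
          · clear h5 h7; grind
          · intro B hB
            rcases List.mem_cons.1 hB with rfl | hB
            · intro C hC b hb
              exact h7 T (by simp) C hC b (Finset.mem_of_mem_erase hb)
            · exact h7 B (by simp [hB])
          · clear h5 h7; grind
          · clear h5 h7; grind
          · intro a ha hb
            rcases h10 a ha (by omega) with ⟨B, hB, hB2⟩ | hB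
            · rcases List.mem_cons.1 hB with rfl | hB
              · left; exact ⟨B.erase (n+1), by simp, Finset.mem_erase.2 ⟨by omega, hB2⟩⟩
              · left; exact ⟨B, by simp [hB], hB2⟩
            · right; exact hB
        · rw [mem_succs]
          right; right
          exact ⟨_, _, rfl, by simp [Finset.insert_erase hn]⟩
  · have hr : ∀ B ∈ stk, n+1 ∉ B := fun B hB hh => h6 B hB T hT _ hh hn
    have hc : ∀ B ∈ cl.erase T, n+1 ∉ B := fun B hB hh => by clear h5 h7; grind
    by_cases hs : T = {n+1}
    · subst hs
      refine ⟨(stk, cl.erase {n+1}), ?_, by rw [mem_succs]; simp [Finset.insert_erase hT]⟩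
      constructor <;> dsimp only
      · exact h1
      · clear h5 h7; grind
      · exact h3
      · clear h5 h7; grind
      · intro B hB C hC
        exact h5 B (Finset.mem_of_mem_erase hB) C (Finset.mem_of_mem_erase hC)
      · clear h5 h7; grind
      · intro B hB C hC
        exact h7 B hB C (Finset.mem_of_mem_erase hC)
      · clear h5 h7; grind
      · clear h5 h7; grind
      · intro a ha hb
        have := h10 a ha (by omega)
        clear h5 h7
        grind
    · refine ⟨(T.erase (n+1) :: stk, cl.erase T), ?_, ?_⟩
      · constructor <;> dsimp only
        · intro B hB
          rcases List.mem_cons.1 hB with rfl | hB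
          · by_contra hcon
            push Not at hcon
            apply hs
            ext b
            have := hcon b
            clear h5 h7 h4 h6 h10
            grind
          · exact h1 B hB
        · clear h5 h7; grind
        · simp only [List.pairwise_cons]
          refine ⟨?_, h3⟩
          intro C hC b hb c hc
          have e1 := h7 C hC T hT c hc b (Finset.mem_of_mem_erase hb) _ hn
          have e2 := h6 C hC T hT c hc
          have := h8 C hC c hc
          clear h5 h7
          grind
        · clear h5 h7; grind
        · intro B hB C hC
          exact h5 B (Finset.mem_of_mem_erase hB) C (Finset.mem_of_mem_erase hC)
        · clear h5 h7; grind
        · intro B hB C hC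
          rcases List.mem_cons.1 hB with rfl | hB
          · intro b hb x hx y hy hxb hby
            have hC' := Finset.mem_of_mem_erase hC
            have := h5 C hC' T hT x hx b (Finset.mem_of_mem_erase hb) y hy (n+1) hn hxb hby
            have := h9 C hC' y hy
            clear h5 h7
            grind
          · exact h7 B hB C (Finset.mem_of_mem_erase hC)
        · clear h5 h7; grind
        · clear h5 h7; grind
        · intro a ha hb
          have := h10 a ha (by omega)
          rcases this with ⟨B, hB, hB2⟩ | ⟨B, hB, hB2⟩
          · left; exact ⟨B, by simp [hB], hB2⟩
          · by_cases hBT : B = T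
            · left; exact ⟨T.erase (n+1), by simp, Finset.mem_erase.2 ⟨by omega, hBT ▸ hB2⟩⟩
            · right; exact ⟨B, Finset.mem_erase.2 ⟨hBT, hB⟩, hB2⟩
      · rw [mem_succs]
        right; right
        exact ⟨_, _, rfl, by simp [Finset.insert_erase hn, Finset.insert_erase hT]⟩

noncomputable def St : ℕ → Finset (List (Finset ℕ) × Finset (Finset ℕ))
  | 0 => {([], ∅)}
  | n + 1 => (St n).biUnion (succs n)

theorem mem_St {n x} : x ∈ St n ↔ Val n x.1 x.2 := by
  induction n generalizing x with
  | zero =>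
    obtain ⟨stk, cl⟩ := x
    simp only [St, Finset.mem_singleton, Prod.mk.injEq]
    constructor
    · rintro ⟨rfl, rfl⟩
      constructor <;> simp
      omega
    · intro h
      constructor
      · apply List.eq_nil_iff_forall_not_mem.2
        intro B hB
        obtain ⟨b, hb⟩ := h.ne1 B hB
        have := h.le1 B hB b hb
        omega
      · apply Finset.eq_empty_of_forall_notMem
        intro B hB
        obtain ⟨b, hb⟩ := h.ne2 B hB
        have := h.le2 B hB b hb
        omega
  | succ n ih =>
    simp only [St, Finset.mem_biUnion]
    constructor
    · rintro ⟨y, hy, hx⟩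
      exact val_succs (ih.1 hy) hx
    · intro h
      obtain ⟨y, hy, hx⟩ := exists_pred h
      exact ⟨y, ih.2 hy, hx⟩

noncomputable def stkW (q t : ℝ) : List (Finset ℕ) → ℝ
  | [] => 1
  | T :: r => q * t ^ ((T.card - 1) * r.length) * stkW q t r

noncomputable def DD (stk : List (Finset ℕ)) (cl : Finset (Finset ℕ)) (a : ℕ) : ℕ :=
  dp cl a + stk.countP (fun C => decide (∃ x ∈ C, x < a))

noncomputable def WW (lam s t : ℝ) (x : List (Finset ℕ) × Finset (Finset ℕ)) : ℝ :=
  stkW (Real.sqrt lam) t x.1 *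
    ∏ B ∈ x.2, lam * s ^ DD x.1 x.2 (B.sup id) * t ^ ((B.card - 2) * DD x.1 x.2 (B.sup id))

theorem sup_mem' {B : Finset ℕ} (h : ∃ b, b ∈ B) : B.sup id ∈ B := by
  obtain ⟨b, hb, he⟩ := Finset.exists_mem_eq_sup B h id
  rw [he]; exact hb

theorem dp_insert {X cl a} (h : X ∉ cl) : dp (insert X cl) a =
    dp cl a + if a ∉ X ∧ (∃ x ∈ X, x < a) ∧ (∃ y ∈ X, a < y) then 1 else 0 := by
  unfold dp
  rw [Finset.filter_insert]
  split_ifs with hh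
  · rw [Finset.card_insert_of_notMem]
    simp [h]
  · simp

theorem dp_top {n : ℕ} {cl : Finset (Finset ℕ)} (h : ∀ B ∈ cl, ∀ a ∈ B, a ≤ n) : dp cl n = 0 := by
  unfold dp
  rw [Finset.card_eq_zero, Finset.filter_eq_empty_iff]
  rintro B hB ⟨-, -, y, hy, hlt⟩
  have := h B hB y hy
  omega

theorem count_top {n stk cl} (h : Val n stk cl) :
    stk.countP (fun C => decide (∃ x ∈ C, x < n+1)) = stk.length := by
  rw [List.countP_eq_length]
  intro B hB
  obtain ⟨b, hb⟩ := h.ne1 B hB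
  have := h.le1 B hB b hb
  simp only [decide_eq_true_eq]
  exact ⟨b, hb, by omega⟩

theorem WW_open {n stk cl} (lam s t : ℝ) (h : Val n stk cl) :
    WW lam s t ({n+1} :: stk, cl) = Real.sqrt lam * WW lam s t (stk, cl) := by
  have : ∀ B ∈ cl, DD ({n+1} :: stk) cl (B.sup id) = DD stk cl (B.sup id) := by
    intro B hB
    have := h.le2 B hB _ (sup_mem' (h.ne2 B hB))
    unfold DD
    rw [List.countP_cons_of_neg]
    simp only [Finset.mem_singleton, exists_eq_left, decide_eq_true_eq]
    omega
  simp only [WW, stkW]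
  rw [Finset.prod_congr rfl (fun B hB => by rw [this B hB])]
  simp
  ring

theorem WW_mid {n T r cl} (lam s t : ℝ) (h : Val n (T :: r) cl) :
    WW lam s t (insert (n+1) T :: r, cl) = t ^ r.length * WW lam s t (T :: r, cl) := by
  have : ∀ B ∈ cl, DD (insert (n+1) T :: r) cl (B.sup id) = DD (T :: r) cl (B.sup id) := by
    intro B hB
    have := h.le2 B hB _ (sup_mem' (h.ne2 B hB))
    unfold DD
    have hh : (∃ x ∈ insert (n+1) T, x < B.sup id) ↔ ∃ x ∈ T, x < B.sup id := by
      simp only [Finset.mem_insert, exists_eq_or_imp]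
      constructor
      · rintro (h | h)
        · omega
        · exact h
      · exact Or.inr
    simp only [List.countP_cons, hh]
  simp only [WW, stkW]
  rw [Finset.prod_congr rfl (fun B hB => by rw [this B hB])]
  have h1 : n+1 ∉ T := fun hh => by have := h.le1 T (by simp) _ hh; omega
  have h2 : 0 < T.card := Finset.card_pos.2 (h.ne1 T (by simp))
  rw [Finset.card_insert_of_notMem h1]
  obtain ⟨c, hc⟩ : ∃ c, T.card = c + 1 := ⟨T.card - 1, by omega⟩
  rw [hc]
  simp only [Nat.add_sub_cancel]
  ring

theorem sup_top {n : ℕ} {T : Finset ℕ} (h : ∀ a ∈ T, a ≤ n) : (insert (n+1) T).sup id = n+1 := by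
  apply le_antisymm
  · apply Finset.sup_le
    intro b hb
    rcases Finset.mem_insert.1 hb with rfl | hb
    · simp
    · have := h b hb
      simp only [id]; omega
  · exact Finset.le_sup (f := id) (Finset.mem_insert_self _ _)

theorem WW_single {n stk cl} (lam s t : ℝ) (h : Val n stk cl) :
    WW lam s t (stk, insert {n+1} cl) = lam * s ^ stk.length * WW lam s t (stk, cl) := by
  have hni : {n+1} ∉ cl := fun hh => by have := h.le2 _ hh (n+1) (by simp); omega
  have h1 : ∀ B ∈ cl, DD stk (insert {n+1} cl) (B.sup id) = DD stk cl (B.sup id) := by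
    intro B hB
    have := h.le2 B hB _ (sup_mem' (h.ne2 B hB))
    unfold DD
    rw [dp_insert hni, if_neg]
    · rfl
    · simp only [Finset.mem_singleton, exists_eq_left]
      omega
  have h2 : DD stk (insert {n+1} cl) (n+1) = stk.length := by
    unfold DD
    rw [count_top h, dp_top]
    · simp
    · intro B hB a ha
      rcases Finset.mem_insert.1 hB with rfl | hB
      · simp at ha; omega
      · have := h.le2 B hB a ha; omega
  simp only [WW]
  rw [Finset.prod_insert hni, Finset.prod_congr rfl (fun B hB => by rw [h1 B hB])]
  simp only [Finset.sup_singleton, id, h2]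
  simp
  ring

theorem WW_close {n T r cl} (lam s t : ℝ) (hl : 0 ≤ lam) (h : Val n (T :: r) cl) :
    WW lam s t (r, insert (insert (n+1) T) cl)
      = Real.sqrt lam * s ^ r.length * WW lam s t (T :: r, cl) := by
  have hni : insert (n+1) T ∉ cl := fun hh => by have := h.le2 _ hh (n+1) (by simp); omega
  have h0 : ∀ a ∈ T, a ≤ n := fun a ha => (h.le1 T (by simp) a ha).2
  have h1 : ∀ B ∈ cl, DD r (insert (insert (n+1) T) cl) (B.sup id) = DD (T :: r) cl (B.sup id) := by
    intro B hB
    have hm := sup_mem' (h.ne2 B hB)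
    have := h.le2 B hB _ hm
    have hT : B.sup id ∉ T := fun hh => h.dj2 T (by simp) B hB _ hh hm
    unfold DD
    rw [dp_insert hni, List.countP_cons]
    have : (B.sup id ∉ insert (n+1) T ∧ (∃ x ∈ insert (n+1) T, x < B.sup id) ∧
        (∃ y ∈ insert (n+1) T, B.sup id < y)) ↔ ∃ x ∈ T, x < B.sup id := by
      simp only [Finset.mem_insert, exists_eq_or_imp]
      constructor
      · rintro ⟨-, h | h, -⟩
        · omega
        · exact h
      · intro h
        refine ⟨?_, Or.inr h, Or.inl (by omega)⟩
        rintro (h | h)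
        · omega
        · exact hT h
    simp only [this, decide_eq_true_eq]
    ring
  have h2 : DD r (insert (insert (n+1) T) cl) (n+1) = r.length := by
    have hc := count_top h
    have hle := List.countP_le_length (p := fun C : Finset ℕ => decide (∃ x ∈ C, x < n+1)) (l := r)
    rw [List.countP_cons, List.length_cons] at hc
    unfold DD
    rw [dp_top]
    · split_ifs at hc <;> omega
    · intro B hB a ha
      rcases Finset.mem_insert.1 hB with rfl | hB
      · rcases Finset.mem_insert.1 ha with rfl | ha
        · exact le_rfl
        · have := h0 a ha; omega
      · have := h.le2 B hB a ha; omega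
  simp only [WW, stkW]
  rw [Finset.prod_insert hni, Finset.prod_congr rfl (fun B hB => by rw [h1 B hB]), sup_top h0, h2]
  have h3 : n+1 ∉ T := fun hh => by have := h0 _ hh; omega
  rw [Finset.card_insert_of_notMem h3]
  have h4 : T.card + 1 - 2 = T.card - 1 := by omega
  rw [h4]
  have h5 := Real.mul_self_sqrt hl
  generalize (∏ x ∈ cl, lam * s ^ DD (T :: r) cl (x.sup id) *
    t ^ ((x.card - 2) * DD (T :: r) cl (x.sup id))) = Q
  generalize stkW (Real.sqrt lam) t r = R
  linear_combination (-(R * s ^ r.length * t ^ ((T.card - 1) * r.length) * Q)) * h5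

theorem sum_succs {n x} (lam s t : ℝ) (hl : 0 ≤ lam) (P : Module.End ℝ (ℕ →₀ ℝ))
    (h0 : P (e 0) = Real.sqrt lam • e 1 + lam • e 0)
    (hP : ∀ m, P (e (m+1)) = Real.sqrt lam • e (m+2) + (lam * s ^ (m+1)) • e (m+1)
      + t ^ m • e (m+1) + (Real.sqrt lam * s ^ m) • e m)
    (h : Val n x.1 x.2) :
    ∑ y ∈ succs n x, WW lam s t y • e y.1.length = WW lam s t x • P (e x.1.length) := by
  obtain ⟨stk, cl⟩ := x
  have hc : ∀ B ∈ cl, n+1 ∉ B := fun B hB hh => by have := h.le2 B hB _ hh; omega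
  have hni : cl ≠ insert {n+1} cl := fun hh => by
    have : {n+1} ∈ cl := by rw [hh]; simp
    exact hc _ this (by simp)
  cases stk with
  | nil =>
    simp only [succs]
    rw [Finset.sum_pair (by simp), WW_open lam s t h, WW_single lam s t h]
    simp only [List.length_nil, List.length_cons, h0]
    module
  | cons T r =>
    simp only [succs]
    rw [Finset.sum_insert, Finset.sum_insert, Finset.sum_insert, Finset.sum_singleton,
      WW_open lam s t h, WW_single lam s t h, WW_mid lam s t h, WW_close lam s t hl h]
    · simp only [List.length_cons, hP]
      module
    · simp only [Finset.mem_singleton, Prod.mk.injEq]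
      rintro ⟨hh, -⟩
      have := congrArg List.length hh
      simp at this
    · simp only [Finset.mem_insert, Finset.mem_singleton, Prod.mk.injEq]
      rintro (⟨-, hh⟩ | ⟨hh, -⟩)
      · exact hni hh.symm
      · have := congrArg List.length hh
        simp at this
    · simp only [Finset.mem_insert, Finset.mem_singleton, Prod.mk.injEq]
      rintro (⟨hh, -⟩ | ⟨hh, -⟩ | ⟨hh, -⟩) <;>
      · have := congrArg List.length hh
        simp only [List.length_cons] at this
        omega

theorem pow_eq (lam s t : ℝ) (hl : 0 ≤ lam) (P : Module.End ℝ (ℕ →₀ ℝ))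
    (h0 : P (e 0) = Real.sqrt lam • e 1 + lam • e 0)
    (hP : ∀ m, P (e (m+1)) = Real.sqrt lam • e (m+2) + (lam * s ^ (m+1)) • e (m+1)
      + t ^ m • e (m+1) + (Real.sqrt lam * s ^ m) • e m) (n : ℕ) :
    (P ^ n) (e 0) = ∑ y ∈ St n, WW lam s t y • e y.1.length := by
  induction n with
  | zero => simp [St, WW, stkW]
  | succ n ih =>
    rw [pow_succ', Module.End.mul_apply, ih, map_sum, St, Finset.sum_biUnion]
    · apply Finset.sum_congr rfl
      intro x hx
      rw [sum_succs lam s t hl P h0 hP (mem_St.1 hx), map_smul]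
    · intro x hx y hy hxy
      rw [Function.onFun, Finset.disjoint_left]
      intro z hz hz'
      exact hxy (unique_pred (mem_St.1 hx) (mem_St.1 hy) hz hz')

theorem ip_e0 (s : ℝ) (v : ℕ →₀ ℝ) : ip s v (e 0) = v 0 := by
  unfold ip
  rw [Finset.sum_eq_single 0]
  · simp [e]
  · intro b _ hb
    simp [e, Ne.symm hb]
  · intro hh
    exfalso; apply hh
    simp [e]

theorem mem_NCset {n π} : π ∈ NCset n ↔ Val n [] π := by
  unfold NCset
  rw [Finset.mem_filter]
  constructor
  · rintro ⟨-, ⟨h1, h2, h3⟩, h4⟩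
    constructor
    · simp
    · exact h1
    · simp
    · intro B hB C hC a ha hb
      by_contra hne
      exact Finset.disjoint_left.1 (h2 B hB C hC hne) ha hb
    · intro B hB C hC b₁ hb₁ c₁ hc₁ b₂ hb₂ c₂ hc₂ i j k
      by_contra hne
      exact h4 ⟨B, hB, C, hC, hne, b₁, hb₁, c₁, hc₁, b₂, hb₂, c₂, hc₂, i, j, k⟩
    · simp
    · simp
    · simp
    · intro B hB a ha
      exact Finset.mem_Icc.1 ((h3 a).2 ⟨B, hB, ha⟩)
    · intro a i j
      exact Or.inr ((h3 a).1 (Finset.mem_Icc.2 ⟨i, j⟩))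
  · intro h
    refine ⟨?_, ⟨h.ne2, ?_, ?_⟩, ?_⟩
    · rw [Finset.mem_powerset]
      intro B hB
      rw [Finset.mem_powerset]
      intro a ha
      exact Finset.mem_Icc.2 (h.le2 B hB a ha)
    · intro B hB C hC hne
      rw [Finset.disjoint_left]
      intro a ha hb
      exact hne (h.dj B hB C hC a ha hb)
    · intro a
      constructor
      · intro ha
        rw [Finset.mem_Icc] at ha
        simpa using h.cov a ha.1 ha.2
      · rintro ⟨B, hB, ha⟩
        exact Finset.mem_Icc.2 (h.le2 B hB a ha)
    · rintro ⟨B, hB, C, hC, hne, b₁, hb₁, c₁, hc₁, b₂, hb₂, c₂, hc₂, i, j, k⟩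
      exact hne (h.nc B hB C hC b₁ hb₁ c₁ hc₁ b₂ hb₂ c₂ hc₂ i j k)

theorem WW_nil (lam s t : ℝ) (π : Finset (Finset ℕ)) :
    WW lam s t ([], π) = lam ^ π.card * s ^ td1 π * t ^ td2 π := by
  simp only [WW, stkW, DD, List.countP_nil, add_zero, one_mul, td1, td2]
  rw [Finset.prod_mul_distrib, Finset.prod_mul_distrib, Finset.prod_const,
    Finset.prod_pow_eq_pow_sum, Finset.prod_pow_eq_pow_sum]

theorem stmt9 (lam s t : ℝ) (hlam : 0 < lam)
    (hs : 0 < s) (hs1 : s ≤ 1) (ht : 0 < t) (ht1 : t ≤ 1)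
    (a adag k mt : Module.End ℝ (ℕ →₀ ℝ))
    (ha0 : a (e 0) = 0)
    (ha : ∀ m : ℕ, 1 ≤ m → a (e m) = s ^ (m - 1) • e (m - 1))
    (hadag : ∀ m : ℕ, adag (e m) = e (m + 1))
    (hk : ∀ m : ℕ, k (e m) = s ^ m • e m)
    (hmt0 : mt (e 0) = 0)
    (hmt : ∀ m : ℕ, 1 ≤ m → mt (e m) = t ^ (m - 1) • e m)
    (n : ℕ) :
    ip s (((mt + Real.sqrt lam • (adag + a) + lam • k) ^ n) (e 0)) (e 0)
      = ∑ π ∈ NCset n, lam ^ π.card * s ^ td1 π * t ^ td2 π := by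

  have h0 : (mt + Real.sqrt lam • (adag + a) + lam • k) (e 0)
      = Real.sqrt lam • e 1 + lam • e 0 := by
    simp [ha0, hadag, hk, hmt0]
  have hP : ∀ m, (mt + Real.sqrt lam • (adag + a) + lam • k) (e (m+1))
      = Real.sqrt lam • e (m+2) + (lam * s ^ (m+1)) • e (m+1)
      + t ^ m • e (m+1) + (Real.sqrt lam * s ^ m) • e m := by
    intro m
    simp only [LinearMap.add_apply, LinearMap.smul_apply, hadag, hk, ha (m+1) (by omega),
      hmt (m+1) (by omega), Nat.add_sub_cancel]
    module
  rw [ip_e0, pow_eq lam s t hlam.le _ h0 hP, Finsupp.finsetSum_apply]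
  symm
  rw [← Finset.sum_filter_add_sum_filter_not (St n) (fun y => y.1 = [])]
  rw [Finset.sum_eq_zero (s := (St n).filter (fun y => ¬ y.1 = []))]
  · rw [add_zero]
    refine Finset.sum_bij (fun π _ => ([], π)) ?_ ?_ ?_ ?_
    · intro π hπ
      simp only [Finset.mem_filter, and_true]
      exact mem_St.2 (mem_NCset.1 hπ)
    · intro π _ π' _ hh
      exact (Prod.mk.inj hh).2
    · rintro ⟨stk, cl⟩ hx
      simp only [Finset.mem_filter] at hx
      obtain ⟨hx, rfl⟩ := hx
      exact ⟨cl, mem_NCset.2 (mem_St.1 hx), rfl⟩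
    · intro π _
      rw [WW_nil]
      simp [e]
  · intro y hy
    have : y.1.length ≠ 0 := by
      simpa using (Finset.mem_filter.1 hy).2
    simp [e, this]
end

section
/- For λ = 1, the number of non-crossing partitions of [n] in which every inner block has size at most 2 equals 1, 2, 5, 14, 41, 123, 374 for n = 1, 2, 3, 4, 5, 6, 7 respectively. -/
open scoped Classical

/-- `B` is an inner block of `π`: some other block `C` satisfies
`min C < min B` and `max B < max C`. -/
def InnerBlock (π : Finset (Finset ℕ)) (B : Finset ℕ) : Prop :=
  ∃ C ∈ π, C ≠ B ∧ (∃ x ∈ C, ∀ b ∈ B, x < b) ∧ (∃ y ∈ C, ∀ b ∈ B, b < y)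

/-- The number of non-crossing partitions of `[n]` in which every inner block
has size at most 2. -/
noncomputable def countGood (n : ℕ) : ℕ :=
  ((NCset n).filter fun π => ∀ B ∈ π, InnerBlock π B → B.card ≤ 2).card


def wf (w : List ℕ) (i : ℕ) : ℕ := w.getD i 0

def forceL {α : Type} : List ℕ → (List ℕ → α) → α
  | [], f => f []
  | 0 :: l, f => forceL l fun l' => f (0 :: l')
  | (m + 1) :: l, f => forceL l fun l' => f ((m + 1) :: l')

lemma forceL_eq {α : Type} (w : List ℕ) : ∀ f : List ℕ → α, forceL w f = f w := by
  induction w with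
  | nil => intro f; rfl
  | cons a l ih =>
    intro f
    cases a with
    | zero => rw [forceL, ih]
    | succ m => rw [forceL, ih]

def extW (n : ℕ) (w0 : List ℕ) : List (List ℕ) := forceL w0 fun w =>
  ((List.range (n + 2)).filter fun k =>
    Nat.blt 0 k && (Nat.beq k (n + 1) || Nat.beq (wf w k) k)).map fun k => w ++ [k]

def wordsOf : ℕ → List (List ℕ)
  | 0 => [[0]]
  | n + 1 => (wordsOf n).flatMap (extW n)

def lastW (d : ℕ) (w0 : List ℕ) : Bool := forceL w0 fun w =>
  (List.range d).all fun b => !(Nat.beq (wf w b) (wf w d)) ||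
    (((List.range d).all fun c => !(Nat.blt b c) ||
      (List.range b).all fun a => !(Nat.beq (wf w a) (wf w c)) || Nat.beq (wf w a) (wf w b)) &&
    ((List.range d).all fun k => !(Nat.blt b k) ||
      (List.range k).all fun j => !(Nat.blt b j) || !(Nat.beq (wf w j) (wf w k)) ||
      (List.range j).all fun i => !(Nat.blt b i) || !(Nat.beq (wf w i) (wf w j)) ||
        Nat.beq (wf w b) (wf w i)))

def goodW (n : ℕ) (w : List ℕ) : Bool := (List.range (n + 1)).all fun d => lastW d w

def goodsOf : ℕ → List (List ℕ)
  | 0 => [[0]]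
  | n + 1 => ((goodsOf n).flatMap (extW n)).filter (lastW (n + 1))

lemma goodW_iff (n : ℕ) (w : List ℕ) : goodW n w = true ↔
    (∀ a b c d, a < b → b < c → c < d → d ≤ n → wf w a = wf w c → wf w b = wf w d →
      wf w a = wf w b) ∧
    (∀ x i j k y, x < i → i < j → j < k → k < y → y ≤ n → wf w x = wf w y → wf w i = wf w j →
      wf w j = wf w k → wf w x = wf w i) := by
  simp only [goodW, lastW, forceL_eq, Bool.and_eq_true, List.all_eq_true, List.mem_range, Bool.or_eq_true,
    Bool.not_eq_true', Nat.beq_eq, Nat.blt_eq, Bool.eq_false_iff, ne_eq]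
  constructor
  · intro h
    refine ⟨fun a b c d hab hbc hcd hd e1 e2 => ?_, fun x i j k y hx hi hj hk hy e1 e2 e3 => ?_⟩
    · have := ((h d (by omega) b (by omega)).resolve_left (not_not.2 e2)).1 c hcd
      have := this.resolve_left (not_not.2 hbc) a hab
      tauto
    · have := ((h y (by omega) x (by omega)).resolve_left (not_not.2 e1)).2 k hk
      have := this.resolve_left (by omega) j hj
      have := this.resolve_left (by omega) i hi
      exact this.resolve_left (by omega)
  · rintro ⟨h1, h2⟩ d hd b hb
    refine or_iff_not_imp_left.2 fun e => ⟨fun c hc => or_iff_not_imp_left.2 fun hbc a ha =>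
        or_iff_not_imp_left.2 fun e1 => ?_, fun k hk => or_iff_not_imp_left.2 fun hxk j hj =>
        or_iff_not_imp_left.2 fun e3 i hi => or_iff_not_imp_left.2 fun e2 => ?_⟩
    · exact h1 a b c d ha (not_not.1 hbc) hc (by omega) (not_not.1 e1) (not_not.1 e)
    · exact h2 b i j k d (by omega) hi hj hk (by omega) (by omega) (by omega) (by omega)

def Canon (n : ℕ) (w : List ℕ) : Prop :=
  w.length = n + 1 ∧ wf w 0 = 0 ∧
    ∀ i, 1 ≤ i → i ≤ n → 1 ≤ wf w i ∧ wf w i ≤ i ∧ wf w (wf w i) = wf w i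

lemma wf_append_lt (w : List ℕ) (k i : ℕ) (h : i < w.length) : wf (w ++ [k]) i = wf w i := by
  simp [wf, List.getD_eq_getElem?_getD, List.getElem?_append_left h]

lemma wf_append_eq (w : List ℕ) (k i : ℕ) (h : i = w.length) : wf (w ++ [k]) i = k := by
  subst h; simp [wf, List.getD_eq_getElem?_getD]

lemma mem_wordsOf (n : ℕ) : ∀ w, w ∈ wordsOf n ↔ Canon n w := by
  induction n with
  | zero =>
    intro w
    simp only [wordsOf, List.mem_singleton, Canon]
    constructor
    · rintro rfl
      exact ⟨rfl, rfl, fun i h1 h2 => by omega⟩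
    · rintro ⟨h1, h2, -⟩
      obtain ⟨a, rfl⟩ := List.length_eq_one_iff.1 h1
      simpa [wf] using h2
  | succ n ih =>
    intro w
    simp only [wordsOf, extW, forceL_eq, List.mem_flatMap, List.mem_map, List.mem_filter, List.mem_range,
      Bool.and_eq_true, Bool.or_eq_true, Nat.beq_eq, Nat.blt_eq, ih]
    constructor
    · rintro ⟨v, ⟨hl, h0, hv⟩, k, ⟨hk, hk0, hk2⟩, rfl⟩
      refine ⟨by simp [hl], by rw [wf_append_lt _ _ _ (by omega), h0], fun i h1 h2 => ?_⟩
      rcases Nat.lt_or_ge i (n + 1) with h | h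
      · obtain ⟨a, b, c⟩ := hv i h1 (by omega)
        rw [wf_append_lt _ _ _ (by omega), wf_append_lt _ _ _ (by omega)]
        exact ⟨a, b, c⟩
      · have : i = v.length := by omega
        rw [wf_append_eq _ _ _ this]
        refine ⟨hk0, by omega, ?_⟩
        rcases Nat.lt_or_ge k (n + 1) with h | h
        · rw [wf_append_lt _ _ _ (by omega)]
          rcases hk2 with h | h
          · omega
          · exact h
        · rw [wf_append_eq _ _ _ (by omega)]
    · rintro ⟨hl, h0, hw⟩
      obtain ⟨v, k, rfl⟩ : ∃ v k, w = v ++ [k] := by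
        have hne : w ≠ [] := by rintro rfl; simp at hl
        exact ⟨w.dropLast, w.getLast hne, (List.dropLast_append_getLast hne).symm⟩
      have hvl : v.length = n + 1 := by simpa using hl
      have hk := hw (n + 1) (by omega) le_rfl
      rw [wf_append_eq _ _ _ hvl.symm] at hk
      refine ⟨v, ⟨hvl, ?_, fun i h1 h2 => ?_⟩, k, ⟨by omega, by omega, ?_⟩, rfl⟩
      · rwa [wf_append_lt _ _ _ (by omega)] at h0
      · have := hw i h1 (by omega)
        rw [wf_append_lt _ _ i (by omega)] at this
        rwa [wf_append_lt _ _ _ (by omega)] at this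
      · rcases Nat.lt_or_ge k (n + 1) with h | h
        · right
          have := hk.2.2
          rwa [wf_append_lt _ _ _ (by omega)] at this
        · left; omega

lemma nodup_wordsOf (n : ℕ) : (wordsOf n).Nodup := by
  induction n with
  | zero => simp [wordsOf]
  | succ n ih =>
    rw [wordsOf, List.nodup_flatMap]
    refine ⟨fun w _ => ?_, ?_⟩
    · rw [extW, forceL_eq]
      apply List.Nodup.map
      · intro a b h
        simpa using h
      · exact List.Nodup.filter _ List.nodup_range
    · refine List.Pairwise.imp ?_ ih
      intro a b hab
      simp only [Function.onFun, extW, forceL_eq, List.disjoint_left, List.mem_map, not_exists, not_and]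
      rintro _ ⟨k, _, rfl⟩ l _ h
      exact hab (List.append_inj' h rfl).1.symm

lemma filter_flatMap_aux (l : List (List ℕ)) (e : List ℕ → List (List ℕ)) (p : List ℕ → Bool)
    (h : ∀ w ∈ l, ∀ v ∈ e w, p v = p w) : (l.flatMap e).filter p = (l.filter p).flatMap e := by
  induction l with
  | nil => simp
  | cons a l ih =>
    have ih' := ih fun w hw => h w (List.mem_cons_of_mem _ hw)
    have ha := h a List.mem_cons_self
    rw [List.flatMap_cons, List.filter_append, ih']
    cases hp : p a with
    | true =>
      rw [List.filter_cons_of_pos hp, List.flatMap_cons,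
        List.filter_eq_self.2 fun v hv => (ha v hv).trans hp]
    | false =>
      rw [List.filter_cons_of_neg (by simp [hp]), List.filter_eq_nil_iff.2, List.nil_append]
      intro v hv
      simp [ha v hv, hp]

lemma goodW_append (n : ℕ) (w : List ℕ) (k : ℕ) (h : w.length = n + 1) :
    goodW n (w ++ [k]) = goodW n w := by
  rw [Bool.eq_iff_iff, goodW_iff, goodW_iff]
  have e : ∀ i, i ≤ n → wf (w ++ [k]) i = wf w i := fun i hi => wf_append_lt _ _ _ (by omega)
  constructor
  · rintro ⟨h1, h2⟩
    refine ⟨fun a b c d hab hbc hcd hd => ?_, fun x i j k y hx hi hj hk hy => ?_⟩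
    · have := h1 a b c d hab hbc hcd hd
      rwa [e a (by omega), e b (by omega), e c (by omega), e d (by omega)] at this
    · have := h2 x i j k y hx hi hj hk hy
      rwa [e x (by omega), e i (by omega), e j (by omega), e k (by omega), e y (by omega)] at this
  · rintro ⟨h1, h2⟩
    refine ⟨fun a b c d hab hbc hcd hd => ?_, fun x i j k y hx hi hj hk hy => ?_⟩
    · have := h1 a b c d hab hbc hcd hd
      rwa [e a (by omega), e b (by omega), e c (by omega), e d (by omega)]
    · have := h2 x i j k y hx hi hj hk hy
      rwa [e x (by omega), e i (by omega), e j (by omega), e k (by omega), e y (by omega)]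

lemma goodsOf_eq (n : ℕ) : goodsOf n = (wordsOf n).filter (goodW n) := by
  induction n with
  | zero => decide +kernel
  | succ n ih =>
    have hs : goodW (n + 1) = fun v => goodW n v && lastW (n + 1) v := by
      funext v
      rw [goodW, List.range_succ, List.all_append]
      simp [goodW]
    rw [goodsOf, ih, wordsOf, hs, ← filter_flatMap_aux, List.filter_filter]
    · congr 1
      funext v
      rw [Bool.and_comm]
    · intro w hw v hv
      rw [extW, forceL_eq, List.mem_map] at hv
      obtain ⟨k, _, rfl⟩ := hv
      exact goodW_append n w k ((mem_wordsOf n w).1 hw).1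

noncomputable def piOf (n : ℕ) (w : List ℕ) : Finset (Finset ℕ) :=
  (Finset.Icc 1 n).image fun i => (Finset.Icc 1 n).filter fun j => wf w j = wf w i

lemma mem_piOf (n : ℕ) (w : List ℕ) (B : Finset ℕ) : B ∈ piOf n w ↔
    ∃ i, (1 ≤ i ∧ i ≤ n) ∧ (Finset.Icc 1 n).filter (fun j => wf w j = wf w i) = B := by
  simp [piOf]

lemma rel_piOf (n : ℕ) (w : List ℕ) (i j : ℕ) : (∃ B ∈ piOf n w, i ∈ B ∧ j ∈ B) ↔
    (1 ≤ i ∧ i ≤ n) ∧ (1 ≤ j ∧ j ≤ n) ∧ wf w i = wf w j := by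
  constructor
  · rintro ⟨B, hB, hi, hj⟩
    obtain ⟨k, hk, rfl⟩ := (mem_piOf _ _ _).1 hB
    simp only [Finset.mem_filter, Finset.mem_Icc] at hi hj
    exact ⟨hi.1, hj.1, hi.2.trans hj.2.symm⟩
  · rintro ⟨hi, hj, h⟩
    exact ⟨_, (mem_piOf _ _ _).2 ⟨i, hi, rfl⟩, by simp [hi], by simp [hj, h]⟩

lemma isPart_piOf (n : ℕ) (w : List ℕ) : IsPartitionOf n (piOf n w) := by
  refine ⟨fun B hB => ?_, fun B hB C hC hne => ?_, fun a => ?_⟩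
  · obtain ⟨k, hk, rfl⟩ := (mem_piOf _ _ _).1 hB
    exact ⟨k, by simp [hk]⟩
  · obtain ⟨k, hk, rfl⟩ := (mem_piOf _ _ _).1 hB
    obtain ⟨l, hl, rfl⟩ := (mem_piOf _ _ _).1 hC
    rw [Finset.disjoint_left]
    intro a ha hb
    simp only [Finset.mem_filter] at ha hb
    exact hne (by rw [← ha.2, ← hb.2])
  · rw [Finset.mem_Icc]
    have := rel_piOf n w a a
    simp only [and_self, and_true] at this
    exact this.symm

lemma good_piOf (n : ℕ) (w : List ℕ) (hw : Canon n w) :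
    (NonCrossing (piOf n w) ∧ ∀ B ∈ piOf n w, InnerBlock (piOf n w) B → B.card ≤ 2) ↔
      goodW n w = true := by
  rw [goodW_iff]
  have h0 : ∀ a c, a < c → c ≤ n → wf w a = wf w c → 1 ≤ a := by
    intro a c hac hc h
    rcases Nat.eq_zero_or_pos a with rfl | h'
    · have := (hw.2.2 c (by omega) hc).1
      have := hw.2.1
      omega
    · exact h'
  have hmem : ∀ i j, i ∈ (Finset.Icc 1 n).filter (fun k => wf w k = wf w j) ↔
      (1 ≤ i ∧ i ≤ n) ∧ wf w i = wf w j := by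
    intro i j; simp
  have hB : ∀ i, 1 ≤ i → i ≤ n → (Finset.Icc 1 n).filter (fun k => wf w k = wf w i) ∈ piOf n w :=
    fun i h1 h2 => (mem_piOf _ _ _).2 ⟨i, ⟨h1, h2⟩, rfl⟩
  have hNC : NonCrossing (piOf n w) ↔ ∀ a b c d, a < b → b < c → c < d → d ≤ n →
      wf w a = wf w c → wf w b = wf w d → wf w a = wf w b := by
    constructor
    · intro h a b c d hab hbc hcd hd e1 e2
      by_contra hne
      have ha := h0 a c (by omega) (by omega) e1
      refine h ⟨_, hB a ha (by omega), _, hB b (by omega) (by omega), ?_, a, ?_, b, ?_, c, ?_, d, ?_,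
        hab, hbc, hcd⟩
      · intro h
        have : a ∈ (Finset.Icc 1 n).filter (fun k => wf w k = wf w a) := by
          rw [hmem]; exact ⟨⟨ha, by omega⟩, rfl⟩
        rw [h, hmem] at this
        exact hne this.2
      all_goals rw [hmem]
      all_goals refine ⟨⟨by omega, by omega⟩, ?_⟩
      all_goals simp [e1, e2]
    · rintro h ⟨B, hB, C, hC, hne, a, ha, b, hb, c, hc, d, hd, hab, hbc, hcd⟩
      obtain ⟨k, hk, rfl⟩ := (mem_piOf _ _ _).1 hB
      obtain ⟨l, hl, rfl⟩ := (mem_piOf _ _ _).1 hC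
      rw [hmem] at ha hb hc hd
      have := h a b c d hab hbc hcd hd.1.2 (ha.2.trans hc.2.symm) (hb.2.trans hd.2.symm)
      exact hne (by rw [← ha.2, ← hb.2, this])
  rw [hNC]
  refine and_congr_right fun hnc => ?_
  constructor
  · intro h x i j k y hx hi hj hk hy e1 e2 e3
    by_contra hne
    have hx1 := h0 x y (by omega) hy e1
    have := h _ (hB i (by omega) (by omega)) ⟨_, hB x hx1 (by omega), ?_, ⟨x, ?_, ?_⟩, ⟨y, ?_, ?_⟩⟩
    · have h3 : ({i, j, k} : Finset ℕ) ⊆ (Finset.Icc 1 n).filter (fun k => wf w k = wf w i) := by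
        intro t ht
        simp only [Finset.mem_insert, Finset.mem_singleton] at ht
        rw [hmem]
        rcases ht with rfl | rfl | rfl
        · exact ⟨⟨by omega, by omega⟩, rfl⟩
        · exact ⟨⟨by omega, by omega⟩, e2.symm⟩
        · exact ⟨⟨by omega, by omega⟩, (e2.trans e3).symm⟩
      have h4 := Finset.card_le_card h3
      rw [Finset.card_eq_three.2 ⟨i, j, k, by omega, by omega, by omega, rfl⟩] at h4
      omega
    · intro h
      have : x ∈ (Finset.Icc 1 n).filter (fun k => wf w k = wf w x) := by
        rw [hmem]; exact ⟨⟨hx1, by omega⟩, rfl⟩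
      rw [h, hmem] at this
      exact hne this.2
    · rw [hmem]; exact ⟨⟨hx1, by omega⟩, rfl⟩
    · intro b hb
      rw [hmem] at hb
      by_contra hlt
      rcases Nat.eq_or_lt_of_le (not_lt.1 hlt) with h' | h'
      · subst h'; exact hne hb.2
      · have := hnc b x i y h' hx (by omega) hy hb.2 e1
        exact hne (this.symm.trans hb.2)
    · rw [hmem]; exact ⟨⟨by omega, by omega⟩, e1.symm⟩
    · intro b hb
      rw [hmem] at hb
      by_contra hlt
      rcases Nat.eq_or_lt_of_le (not_lt.1 hlt) with h' | h'
      · subst h'; exact hne (e1.trans hb.2)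
      · have := hnc x i y b hx (by omega) h' hb.1.2 e1 hb.2.symm
        exact hne this
  · rintro h B hBm ⟨C, hC, hne, ⟨x, hx, hxB⟩, ⟨y, hy, hyB⟩⟩
    obtain ⟨p, hp, rfl⟩ := (mem_piOf _ _ _).1 hBm
    obtain ⟨q, hq, rfl⟩ := (mem_piOf _ _ _).1 hC
    by_contra hc
    have key : ∀ i j k, i < j → j < k →
        i ∈ (Finset.Icc 1 n).filter (fun k => wf w k = wf w p) →
        j ∈ (Finset.Icc 1 n).filter (fun k => wf w k = wf w p) →
        k ∈ (Finset.Icc 1 n).filter (fun k => wf w k = wf w p) → False := by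
      intro i j k hij hjk hi hj hk
      have hxi := hxB i hi
      have hky := hyB k hk
      rw [hmem] at hi hj hk hx hy
      have := h x i j k y hxi hij hjk hky hy.1.2 (hx.2.trans hy.2.symm) (hi.2.trans hj.2.symm)
        (hj.2.trans hk.2.symm)
      exact hne (by rw [← hx.2, ← hi.2, this])
    obtain ⟨a, ha, b, hb, c, hc, hab, hac, hbc⟩ := Finset.two_lt_card.1 (not_le.1 hc)
    rcases Nat.lt_or_gt_of_ne hab with h1 | h1 <;> rcases Nat.lt_or_gt_of_ne hac with h2 | h2 <;>
      rcases Nat.lt_or_gt_of_ne hbc with h3 | h3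
    · exact key a b c h1 h3 ha hb hc
    · exact key a c b h2 h3 ha hc hb
    · omega
    · exact key c a b h2 h1 hc ha hb
    · exact key b a c h1 h2 hb ha hc
    · omega
    · exact key b c a h3 h2 hb hc ha
    · exact key c b a h3 h1 hc hb ha

lemma piOf_inj (n : ℕ) (v w : List ℕ) (hv : Canon n v) (hw : Canon n w)
    (h : piOf n v = piOf n w) : v = w := by
  have hle : ∀ v w : List ℕ, Canon n v → Canon n w → piOf n v = piOf n w →
      ∀ i, 1 ≤ i → i ≤ n → wf w i ≤ wf v i := by
    intro v w hv hw h i h1 h2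
    obtain ⟨a, b, c⟩ := hv.2.2 i h1 h2
    have h3 := (rel_piOf n v (wf v i) i).2 ⟨⟨a, by omega⟩, ⟨h1, h2⟩, c⟩
    rw [h, rel_piOf] at h3
    have := (hw.2.2 (wf v i) a (by omega)).2.1
    omega
  apply List.ext_getElem (by rw [hv.1, hw.1])
  intro i hi hi'
  have e : wf v i = wf w i := by
    rcases Nat.eq_zero_or_pos i with rfl | h'
    · rw [hv.2.1, hw.2.1]
    · have := hv.1
      exact le_antisymm (hle w v hw hv h.symm i h' (by omega)) (hle v w hv hw h i h' (by omega))
  simpa [wf, hi, hi'] using e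

lemma piOf_surj (n : ℕ) (π : Finset (Finset ℕ)) (h : IsPartitionOf n π) :
    ∃ w, Canon n w ∧ piOf n w = π := by
  obtain ⟨hne, hd, hu⟩ := h
  have huniq : ∀ B ∈ π, ∀ C ∈ π, ∀ a, a ∈ B → a ∈ C → B = C := by
    intro B hB C hC a ha hb
    by_contra hn
    exact Finset.disjoint_left.1 (hd B hB C hC hn) ha hb
  have hm : ∀ i, ∃ m, (i ∈ Finset.Icc 1 n → ∃ B ∈ π, i ∈ B ∧ m ∈ B ∧ ∀ b ∈ B, m ≤ b) ∧
      (i ∉ Finset.Icc 1 n → m = 0) := by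
    intro i
    by_cases hi : i ∈ Finset.Icc 1 n
    · obtain ⟨B, hB, hiB⟩ := (hu i).1 hi
      exact ⟨B.min' ⟨i, hiB⟩, fun _ => ⟨B, hB, hiB, Finset.min'_mem _ _,
        fun b hb => Finset.min'_le _ _ hb⟩, fun h => absurd hi h⟩
    · exact ⟨0, fun h => absurd h hi, fun _ => rfl⟩
  choose m hm1 hm2 using hm
  have hin : ∀ B ∈ π, ∀ a ∈ B, a ∈ Finset.Icc 1 n := fun B hB a ha => (hu a).2 ⟨B, hB, ha⟩
  have heq : ∀ B ∈ π, ∀ i ∈ B, ∀ j ∈ Finset.Icc 1 n, (m j = m i ↔ j ∈ B) := by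
    intro B hB i hi j hj
    obtain ⟨C, hC, hiC, hmC, hC'⟩ := hm1 i (hin B hB i hi)
    obtain rfl := huniq B hB C hC i hi hiC
    obtain ⟨D, hD, hjD, hmD, hD'⟩ := hm1 j hj
    constructor
    · intro h
      rw [h] at hmD
      obtain rfl := huniq B hB D hD _ hmC hmD
      exact hjD
    · intro h
      obtain rfl := huniq B hB D hD _ h hjD
      exact le_antisymm (hD' _ hmC) (hC' _ hmD)
  have hwf : ∀ i, i ≤ n → wf ((List.range (n + 1)).map m) i = m i := by
    intro i hi
    have : i < n + 1 := by omega
    simp [wf, this]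
  refine ⟨(List.range (n + 1)).map m, ⟨by simp, ?_, ?_⟩, ?_⟩
  · rw [hwf 0 (by omega)]; exact hm2 0 (by simp)
  · intro i h1 h2
    obtain ⟨C, hC, hiC, hmC, hC'⟩ := hm1 i (Finset.mem_Icc.2 ⟨h1, h2⟩)
    have h3 := hin C hC _ hmC
    rw [hwf i h2]
    rw [hwf _ (Finset.mem_Icc.1 h3).2]
    exact ⟨(Finset.mem_Icc.1 h3).1, hC' i hiC, (heq C hC i hiC _ h3).2 hmC⟩
  · have hblk : ∀ B ∈ π, ∀ i ∈ B, (Finset.Icc 1 n).filter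
        (fun j => wf ((List.range (n + 1)).map m) j = wf ((List.range (n + 1)).map m) i) = B := by
      intro B hB i hi
      ext j
      have hi' := Finset.mem_Icc.1 (hin B hB i hi)
      rw [Finset.mem_filter]
      constructor
      · rintro ⟨hj, e⟩
        rw [hwf i hi'.2, hwf j (Finset.mem_Icc.1 hj).2] at e
        exact (heq B hB i hi j hj).1 e
      · intro hj
        have hj' := hin B hB j hj
        refine ⟨hj', ?_⟩
        rw [hwf i hi'.2, hwf j (Finset.mem_Icc.1 hj').2]
        exact (heq B hB i hi j hj').2 hj
    ext B
    rw [mem_piOf]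
    constructor
    · rintro ⟨i, hi, rfl⟩
      obtain ⟨C, hC, hiC⟩ := (hu i).1 (Finset.mem_Icc.2 hi)
      rw [hblk C hC i hiC]
      exact hC
    · intro hB
      obtain ⟨i, hi⟩ := hne B hB
      exact ⟨i, Finset.mem_Icc.1 (hin B hB i hi), hblk B hB i hi⟩

lemma countGood_eq (n : ℕ) : countGood n = ((wordsOf n).filter (goodW n)).length := by
  rw [← List.toFinset_card_of_nodup ((nodup_wordsOf n).filter _), countGood]
  symm
  apply Finset.card_bij (fun w _ => piOf n w)
  · intro w hw
    rw [List.mem_toFinset, List.mem_filter, mem_wordsOf] at hw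
    have hg := (good_piOf n w hw.1).2 hw.2
    simp only [Finset.mem_filter, NCset, Finset.mem_powerset]
    refine ⟨⟨?_, isPart_piOf n w, hg.1⟩, hg.2⟩
    intro B hB
    obtain ⟨k, hk, rfl⟩ := (mem_piOf _ _ _).1 hB
    exact Finset.mem_powerset.2 (Finset.filter_subset _ _)
  · intro v hv w hw h
    rw [List.mem_toFinset, List.mem_filter, mem_wordsOf] at hv hw
    exact piOf_inj n v w hv.1 hw.1 h
  · intro π hπ
    simp only [Finset.mem_filter, NCset] at hπ
    obtain ⟨w, hw, rfl⟩ := piOf_surj n π hπ.1.2.1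
    refine ⟨w, ?_, rfl⟩
    rw [List.mem_toFinset, List.mem_filter, mem_wordsOf]
    exact ⟨hw, (good_piOf n w hw).1 ⟨hπ.1.2.2, hπ.2⟩⟩

theorem stmt18 :
    countGood 1 = 1 ∧ countGood 2 = 2 ∧ countGood 3 = 5 ∧ countGood 4 = 14 ∧
    countGood 5 = 41 ∧ countGood 6 = 123 ∧ countGood 7 = 374 := by
  simp only [countGood_eq, ← goodsOf_eq]
  refine ⟨?_, ?_, ?_, ?_, ?_, ?_, ?_⟩ <;> decide +kernel
end
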